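/- arXiv:2505.03693 — 7 statements merged into one kernel-verified Lean document; each statement's English description precedes it below -/
import Mathlib

section
/- (Fixed Point Induction) Let X₁, X₂ be recursion variables, I a state predicate, V a valuation, and Φ, Ψ trace formulas in which X₂ does not occur free in Φ and X₁ does not occur free in Ψ. If for all γ₁, γ₂ ⊆ State⁺ the inclusion ⟦I⟧_V ∩ γ₁ ⊆ γ₂ implies ⟦I⟧_V ∩ ⟦Φ⟧_{V[X₁↦γ₁]} ⊆ ⟦Ψ⟧_{V[X₂↦γ₂]}, then ⟦I⟧_V ∩ ⟦μX₁.Φ⟧_V ⊆ ⟦μX₂.Ψ⟧_V. -/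
/-- A trace is a nonempty finite list of states (an element of `State⁺`). -/
abbrev Trace (State : Type) : Type := {l : List State // l ≠ []}

/-- Trace formulas: `Φ ::= p | R | Φ∧Φ | Φ∨Φ | Φ⌢Φ | X | μX.Φ`. -/
inductive TF (State RVar : Type) : Type where
  | pred : (State → Prop) → TF State RVar
  | rel  : (State → State → Prop) → TF State RVar
  | conj : TF State RVar → TF State RVar → TF State RVar
  | disj : TF State RVar → TF State RVar → TF State RVar
  | chop : TF State RVar → TF State RVar → TF State RVar
  | var  : RVar → TF State RVar
  | mu   : RVar → TF State RVar → TF State RVar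

/-- Chop of trace sets: `A ⋈ B = {σ·s·σ' | σ·s ∈ A ∧ s·σ' ∈ B}`,
the two parts overlapping in the single shared state `s`. -/
def chopSet {State : Type} (A B : Set (Trace State)) : Set (Trace State) :=
  {t | ∃ (σ σ' : List State) (s : State),
    t.1 = σ ++ s :: σ' ∧
    (⟨σ ++ [s], by simp⟩ : Trace State) ∈ A ∧
    (⟨s :: σ', by simp⟩ : Trace State) ∈ B}

/-- Semantics of trace formulas under a valuation `V : RVar → 𝒫(State⁺)`. -/
def sem {State RVar : Type} [DecidableEq RVar] :
    TF State RVar → (RVar → Set (Trace State)) → Set (Trace State)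
  | TF.pred p, _ => {t | ∃ (s : State) (σ : List State), t.1 = s :: σ ∧ p s}
  | TF.rel R, _ => {t | ∃ s s', t.1 = [s, s'] ∧ R s s'}
  | TF.conj a b, V => sem a V ∩ sem b V
  | TF.disj a b, V => sem a V ∪ sem b V
  | TF.chop a b, V => chopSet (sem a V) (sem b V)
  | TF.var X, V => V X
  | TF.mu X a, V => ⋂₀ {γ : Set (Trace State) | sem a (Function.update V X γ) ⊆ γ}

/-- The set of free recursion variables of a trace formula. -/
def FV {State RVar : Type} : TF State RVar → Set RVar
  | TF.pred _ => ∅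
  | TF.rel _ => ∅
  | TF.conj a b => FV a ∪ FV b
  | TF.disj a b => FV a ∪ FV b
  | TF.chop a b => FV a ∪ FV b
  | TF.var X => {X}
  | TF.mu X a => FV a \ {X}

/-- Fixed Point Induction: if for all `γ₁ γ₂`,
`⟦I⟧_V ∩ γ₁ ⊆ γ₂` implies `⟦I⟧_V ∩ ⟦Φ⟧_{V[X₁↦γ₁]} ⊆ ⟦Ψ⟧_{V[X₂↦γ₂]}`,
then `⟦I⟧_V ∩ ⟦μX₁.Φ⟧_V ⊆ ⟦μX₂.Ψ⟧_V`
(where `X₂` is not free in `Φ` and `X₁` is not free in `Ψ`). -/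
theorem fixed_point_induction {State RVar : Type} [DecidableEq RVar]
    (X₁ X₂ : RVar) (I : State → Prop) (V : RVar → Set (Trace State))
    (Φ Ψ : TF State RVar)
    (hΦ : X₂ ∉ FV Φ) (hΨ : X₁ ∉ FV Ψ)
    (h : ∀ γ₁ γ₂ : Set (Trace State),
      sem (TF.pred I) V ∩ γ₁ ⊆ γ₂ →
      sem (TF.pred I) V ∩ sem Φ (Function.update V X₁ γ₁) ⊆
        sem Ψ (Function.update V X₂ γ₂)) :
    sem (TF.pred I) V ∩ sem (TF.mu X₁ Φ) V ⊆ sem (TF.mu X₂ Ψ) V := by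
  rintro t ⟨htI, htΦ⟩ γ₂ hγ₂
  have key : t ∈ {u | u ∈ sem (TF.pred I) V → u ∈ γ₂} := by
    refine htΦ _ ?_
    intro u hu huI
    exact hγ₂ (h {u | u ∈ sem (TF.pred I) V → u ∈ γ₂} γ₂ (fun w hw => hw.2 hw.1) ⟨huI, hu⟩)
  exact key htI
end

section
/- (Unsoundness of the rule CH-∧R) There exist a type State, four pairwise distinct states σ₁, σ₂, σ₃, σ₄ in State, and trace sets A₀ = {[σ₁,σ₂,σ₃,σ₄]}, A₁ = {[σ₁], [σ₁,σ₂]}, A₂ = {[σ₁,σ₂], [σ₁,σ₂,σ₃]}, A₃ = {[σ₁,σ₂,σ₃,σ₄], [σ₃,σ₄]} such that A₀ ⊆ A₁ ⋈ A₃ and A₀ ⊆ A₂ ⋈ A₃, but A₀ ⊄ (A₁ ∩ A₂) ⋈ A₃; consequently the inference from ⟦Γ⟧ ⊆ ⟦Ψ₁⌢Ψ₃⟧ and ⟦Γ⟧ ⊆ ⟦Ψ₂⌢Ψ₃⟧ to ⟦Γ⟧ ⊆ ⟦(Ψ₁∧Ψ₂)⌢Ψ₃⟧ is not valid. -/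
/-- Unsoundness of the rule CH-∧R: there exist a type `State`,
four pairwise distinct states `σ₁ σ₂ σ₃ σ₄` and trace sets
`A₀ = {[σ₁,σ₂,σ₃,σ₄]}`, `A₁ = {[σ₁],[σ₁,σ₂]}`, `A₂ = {[σ₁,σ₂],[σ₁,σ₂,σ₃]}`,
`A₃ = {[σ₁,σ₂,σ₃,σ₄],[σ₃,σ₄]}` with `A₀ ⊆ A₁ ⋈ A₃`, `A₀ ⊆ A₂ ⋈ A₃`,
but not `A₀ ⊆ (A₁ ∩ A₂) ⋈ A₃`. -/
theorem ch_and_r_unsound :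
    ∃ (State : Type) (σ₁ σ₂ σ₃ σ₄ : State),
      σ₁ ≠ σ₂ ∧ σ₁ ≠ σ₃ ∧ σ₁ ≠ σ₄ ∧ σ₂ ≠ σ₃ ∧ σ₂ ≠ σ₄ ∧ σ₃ ≠ σ₄ ∧
      ∃ A₀ A₁ A₂ A₃ : Set (Trace State),
        A₀ = {(⟨[σ₁, σ₂, σ₃, σ₄], by simp⟩ : Trace State)} ∧
        A₁ = {(⟨[σ₁], by simp⟩ : Trace State), (⟨[σ₁, σ₂], by simp⟩ : Trace State)} ∧
        A₂ = {(⟨[σ₁, σ₂], by simp⟩ : Trace State),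
              (⟨[σ₁, σ₂, σ₃], by simp⟩ : Trace State)} ∧
        A₃ = {(⟨[σ₁, σ₂, σ₃, σ₄], by simp⟩ : Trace State),
              (⟨[σ₃, σ₄], by simp⟩ : Trace State)} ∧
        A₀ ⊆ chopSet A₁ A₃ ∧
        A₀ ⊆ chopSet A₂ A₃ ∧
        ¬ (A₀ ⊆ chopSet (A₁ ∩ A₂) A₃) := by
  refine ⟨ℕ, 1, 2, 3, 4, by decide, by decide, by decide, by decide, by decide, by decide,
    _, _, _, _, rfl, rfl, rfl, rfl, ?_, ?_, ?_⟩
  · rintro t rfl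
    exact ⟨[], [2, 3, 4], 1, rfl, Or.inl rfl, Or.inl rfl⟩
  · rintro t rfl
    exact ⟨[1, 2], [4], 3, rfl, Or.inr rfl, Or.inr rfl⟩
  · intro h
    obtain ⟨σ, σ', s, -, ⟨h1, h2⟩, h3⟩ := h rfl
    have hs : s = 1 ∨ s = 3 := by
      rcases h3 with h3 | h3
      · left
        have := congrArg (fun t : Trace ℕ => t.1.head?) h3
        simpa using this
      · right
        have := congrArg (fun t : Trace ℕ => t.1.head?) h3
        simpa using this
    have k1 : s = 1 ∨ s = 2 := by
      rcases h1 with h1 | h1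
      · left
        have := congrArg (fun t : Trace ℕ => t.1.getLast?) h1
        simpa using this
      · right
        have := congrArg (fun t : Trace ℕ => t.1.getLast?) h1
        simpa using this
    have k2 : s = 2 ∨ s = 3 := by
      rcases h2 with h2 | h2
      · left
        have := congrArg (fun t : Trace ℕ => t.1.getLast?) h2
        simpa using this
      · right
        have := congrArg (fun t : Trace ℕ => t.1.getLast?) h2
        simpa using this
    omega
end

section
/- (Fixed Point Induction on Contracts) Let Pre, Post ⊆ State be state predicates, X a recursion variable, Φ a trace formula, and V a valuation. Say that the contract (Pre, Post) is valid for a trace set A ⊆ State⁺ if Pre↑ ∩ (A ⋈ State⁺) ⊆ A ⋈ Post↑, where Q↑ := {s·σ ∈ State⁺ | s ∈ Q}. If for every γ ⊆ State⁺ the validity of (Pre, Post) for γ implies its validity for ⟦Φ⟧_{V[X↦γ]}, then (Pre, Post) is valid for ⟦μX.Φ⟧_V. -/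
/-- `Q↑ = {s·σ ∈ State⁺ | s ∈ Q}`: the traces whose first state lies in `Q`. -/
def liftPred {State : Type} (Q : Set State) : Set (Trace State) :=
  {t | ∃ (s : State) (σ : List State), t.1 = s :: σ ∧ s ∈ Q}

/-- The contract `(Pre, Post)` is valid for a trace set `A ⊆ State⁺`:
`Pre↑ ∩ (A ⋈ State⁺) ⊆ A ⋈ Post↑`. -/
def contractValid {State : Type} (Pre Post : Set State) (A : Set (Trace State)) : Prop :=
  liftPred Pre ∩ chopSet A Set.univ ⊆ chopSet A (liftPred Post)

theorem chopSet_mono {State : Type} {A A' B B' : Set (Trace State)}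
    (hA : A ⊆ A') (hB : B ⊆ B') : chopSet A B ⊆ chopSet A' B' := by
  rintro t ⟨σ, σ', s, h1, h2, h3⟩
  exact ⟨σ, σ', s, h1, hA h2, hB h3⟩

theorem sem_mono {State RVar : Type} [DecidableEq RVar] (Φ : TF State RVar) :
    ∀ (V W : RVar → Set (Trace State)), (∀ Y, V Y ⊆ W Y) → sem Φ V ⊆ sem Φ W := by
  induction Φ with
  | pred p => intro V W _; simp only [sem]; exact subset_rfl
  | rel R => intro V W _; simp only [sem]; exact subset_rfl
  | conj a b iha ihb =>
    intro V W h; simp only [sem]; exact Set.inter_subset_inter (iha V W h) (ihb V W h)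
  | disj a b iha ihb =>
    intro V W h; simp only [sem]; exact Set.union_subset_union (iha V W h) (ihb V W h)
  | chop a b iha ihb =>
    intro V W h; simp only [sem]; exact chopSet_mono (iha V W h) (ihb V W h)
  | var Y => intro V W h; simp only [sem]; exact h Y
  | mu Y a iha =>
    intro V W h
    simp only [sem]
    intro t ht γ hγ
    refine ht γ (Set.Subset.trans (iha _ _ ?_) hγ)
    intro Z
    by_cases hZ : Z = Y
    · subst hZ; simp
    · simpa [Function.update_of_ne hZ] using h Z

theorem contractValid_sUnion {State : Type} (Pre Post : Set State)
    (S : Set (Set (Trace State))) (hS : ∀ A ∈ S, contractValid Pre Post A) :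
    contractValid Pre Post (⋃₀ S) := by
  rintro t ⟨hp, σ, σ', s, h1, ⟨A, hA, h2⟩, h3⟩
  exact chopSet_mono (Set.subset_sUnion_of_mem hA) subset_rfl
    (hS A hA ⟨hp, σ, σ', s, h1, h2, h3⟩)

/-- Fixed Point Induction on Contracts: if for every `γ`,
validity of `(Pre, Post)` for `γ` implies its validity for `⟦Φ⟧_{V[X↦γ]}`,
then `(Pre, Post)` is valid for `⟦μX.Φ⟧_V`. -/
theorem fpi_on_contracts {State RVar : Type} [DecidableEq RVar]
    (Pre Post : Set State) (X : RVar) (Φ : TF State RVar)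
    (V : RVar → Set (Trace State))
    (h : ∀ γ : Set (Trace State), contractValid Pre Post γ →
      contractValid Pre Post (sem Φ (Function.update V X γ))) :
    contractValid Pre Post (sem (TF.mu X Φ) V) := by
  let f : Set (Trace State) →o Set (Trace State) :=
    { toFun := fun γ => sem Φ (Function.update V X γ)
      monotone' := by
        intro a b hab
        apply sem_mono
        intro Z
        by_cases hZ : Z = X
        · subst hZ; simpa using hab
        · simp [Function.update_of_ne hZ] }
  have key : sem (TF.mu X Φ) V = OrderHom.lfp f := by
    simp only [sem]; rfl
  rw [key]
  exact OrderHom.lfp_induction f (fun a ha _ => h a ha)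
    (fun S hS => contractValid_sUnion Pre Post S hS)
end

section
/- (Local soundness of rule CH-ID) Let Γ be a finite set of trace formulas, P_Γ the set of state predicates occurring as members of Γ, Φ, Ψ₁, …, Ψₙ, Ψ₁', …, Ψₙ' trace formulas, D ⊆ State⁺, and V a valuation. If ⟦⋀P_Γ⟧_V ∩ ⟦Id⟧_V ⊆ ⟦Ψᵢ⟧_V for every 1 ≤ i ≤ n, and ⟦⋀P_Γ⟧_V ∩ ⟦Φ⟧_V ⊆ ⋃_{1≤i≤n} ⟦Ψᵢ'⟧_V, then ⟦⋀Γ⟧_V ∩ ⟦Id ⌢ Φ⟧_V ⊆ ⋃_{1≤i≤n} ⟦Ψᵢ ⌢ Ψᵢ'⟧_V ∪ D. -/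
/-- `⟦⋀Γ⟧_V`: intersection of the semantics of the members of a finite set
`Γ` of trace formulas (`State⁺` for `Γ = ∅`). -/
def semAll {State RVar : Type} [DecidableEq RVar]
    (Γ : List (TF State RVar)) (V : RVar → Set (Trace State)) : Set (Trace State) :=
  {t | ∀ φ ∈ Γ, t ∈ sem φ V}

/-- `⟦⋀P_Γ⟧_V`, where `P_Γ` is the set of state predicates occurring as
members of `Γ`: the traces whose first state satisfies every predicate of
`P_Γ`. -/
def semPreds {State RVar : Type} [DecidableEq RVar]
    (Γ : List (TF State RVar)) (V : RVar → Set (Trace State)) : Set (Trace State) :=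
  {t | ∀ p : State → Prop, TF.pred p ∈ Γ → t ∈ sem (TF.pred p) V}

/-- Local soundness of rule CH-ID: if
`⟦⋀P_Γ⟧_V ∩ ⟦Id⟧_V ⊆ ⟦Ψᵢ⟧_V` for every `i` and
`⟦⋀P_Γ⟧_V ∩ ⟦Φ⟧_V ⊆ ⋃ᵢ ⟦Ψᵢ'⟧_V`, then
`⟦⋀Γ⟧_V ∩ ⟦Id ⌢ Φ⟧_V ⊆ ⋃ᵢ ⟦Ψᵢ ⌢ Ψᵢ'⟧_V ∪ D`. -/
theorem ch_id_sound {State RVar : Type} [DecidableEq RVar]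
    (Γ : List (TF State RVar)) (n : ℕ) (Ψ Ψ' : Fin n → TF State RVar)
    (Φ : TF State RVar) (D : Set (Trace State)) (V : RVar → Set (Trace State))
    (h1 : ∀ i : Fin n,
      semPreds Γ V ∩ sem (TF.rel (fun s s' => s = s') : TF State RVar) V ⊆ sem (Ψ i) V)
    (h2 : semPreds Γ V ∩ sem Φ V ⊆ ⋃ i : Fin n, sem (Ψ' i) V) :
    semAll Γ V ∩ sem (TF.chop (TF.rel fun s s' => s = s') Φ) V ⊆
      (⋃ i : Fin n, sem (TF.chop (Ψ i) (Ψ' i)) V) ∪ D := by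
  rintro t ⟨hΓ, σ, σ', s, ht, ⟨a, b, hab, rfl⟩, hΦ⟩
  have hσ : σ = [s] := by
    have h : σ ++ [s] = [a] ++ [a] := hab
    have h' := List.append_inj' h rfl
    have h3 : s = a := by simpa using h'.2
    rw [h'.1, h3]
  subst hσ
  have hp : ∀ p : State → Prop, TF.pred p ∈ Γ → p s := by
    intro p hpΓ
    obtain ⟨u, τ, hu, hpu⟩ := hΓ _ hpΓ
    rw [ht] at hu
    have h : s = u := by
      simp at hu
      exact hu.1
    rw [h]
    exact hpu
  have hmem := h2 ⟨fun p hpΓ => ⟨s, σ', rfl, hp p hpΓ⟩, hΦ⟩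
  obtain ⟨i, hi⟩ := Set.mem_iUnion.1 hmem
  refine Or.inl (Set.mem_iUnion.2 ⟨i, [s], σ', s, ht, ?_, hi⟩)
  exact h1 i ⟨fun p hpΓ => ⟨s, [s], rfl, hp p hpΓ⟩, s, s, rfl, rfl⟩
end

section
/- (Local soundness of rule ARB2) For all trace formulas Φ₁, Φ₂, Ψ, every trace set A, D ⊆ State⁺, and every valuation V: if A ∩ ⟦Φ₁ ⌢ Φ₂⟧_V ⊆ ⟦Φ₁ ⌢ (true ⌢ Ψ)⟧_V ∪ D, then A ∩ ⟦Φ₁ ⌢ Φ₂⟧_V ⊆ ⟦true ⌢ Ψ⟧_V ∪ D, where true is the state predicate satisfied by every state. -/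
/-- Local soundness of rule ARB2: if
`A ∩ ⟦Φ₁ ⌢ Φ₂⟧_V ⊆ ⟦Φ₁ ⌢ (true ⌢ Ψ)⟧_V ∪ D`, then
`A ∩ ⟦Φ₁ ⌢ Φ₂⟧_V ⊆ ⟦true ⌢ Ψ⟧_V ∪ D`, where `true` is the state predicate
satisfied by every state. -/
theorem arb2_sound {State RVar : Type} [DecidableEq RVar]
    (Φ₁ Φ₂ Ψ : TF State RVar) (A D : Set (Trace State))
    (V : RVar → Set (Trace State))
    (h : A ∩ sem (TF.chop Φ₁ Φ₂) V ⊆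
      sem (TF.chop Φ₁ (TF.chop (TF.pred fun _ => True) Ψ)) V ∪ D) :
    A ∩ sem (TF.chop Φ₁ Φ₂) V ⊆
      sem (TF.chop (TF.pred fun _ => True) Ψ) V ∪ D := by
  intro t ht
  rcases h ht with h1 | h1
  · left
    simp only [sem] at h1 ⊢
    obtain ⟨σ, σ', s, e, _, τ, τ', r, e', _, hΨ⟩ := h1
    have e2 : s :: σ' = τ ++ r :: τ' := e'
    refine ⟨σ ++ τ, τ', r, ?_, ?_, hΨ⟩
    · rw [e, e2, List.append_assoc]
    · obtain ⟨a, l, hl⟩ := List.exists_cons_of_ne_nil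
        (show (σ ++ τ) ++ [r] ≠ [] by simp)
      exact ⟨a, l, hl, trivial⟩
  · exact Or.inr h1
end

section
/- (Local soundness of rule CH-PREDR) For every state predicate q, every trace formula Ψ, trace sets A, D ⊆ State⁺, and every valuation V: if A ∩ ⟦q⟧_V ⊆ ⟦true ⌢ Ψ⟧_V ∪ D, then A ∩ ⟦q⟧_V ⊆ ⟦q ⌢ Ψ⟧_V ∪ D, where true is the state predicate satisfied by every state. -/
/-- Local soundness of rule CH-PREDR: if
`A ∩ ⟦q⟧_V ⊆ ⟦true ⌢ Ψ⟧_V ∪ D` then `A ∩ ⟦q⟧_V ⊆ ⟦q ⌢ Ψ⟧_V ∪ D`,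
where `true` is the state predicate satisfied by every state. -/
theorem ch_predr_sound {State RVar : Type} [DecidableEq RVar]
    (q : State → Prop) (Ψ : TF State RVar) (A D : Set (Trace State))
    (V : RVar → Set (Trace State))
    (h : A ∩ sem (TF.pred q : TF State RVar) V ⊆
      sem (TF.chop (TF.pred fun _ => True) Ψ) V ∪ D) :
    A ∩ sem (TF.pred q : TF State RVar) V ⊆
      sem (TF.chop (TF.pred q) Ψ) V ∪ D := by
  rintro t ⟨hA, hq⟩
  rcases h ⟨hA, hq⟩ with hc | hD
  · left
    simp only [sem, chopSet, Set.mem_setOf_eq] at hc hq ⊢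
    obtain ⟨σ, σ', s, ht, -, hΨ⟩ := hc
    obtain ⟨s₀, ρ, ht₀, hs₀⟩ := hq
    refine ⟨σ, σ', s, ht, ?_, hΨ⟩
    rw [ht] at ht₀
    cases σ with
    | nil =>
      simp only [List.nil_append, List.cons.injEq] at ht₀
      exact ⟨s, [], rfl, ht₀.1 ▸ hs₀⟩
    | cons a τ =>
      simp only [List.cons_append, List.cons.injEq] at ht₀
      exact ⟨a, τ ++ [s], rfl, ht₀.1 ▸ hs₀⟩
  · exact Or.inr hD
end

section
/- (Local soundness of rule END-ID) Let P be a set of state predicates, Ψ₁, Ψ₂ trace formulas, and V a valuation. If ⟦⋀P⟧_V ∩ ⟦Id⟧_V ⊆ ⟦Ψ₁⟧_V and ⟦⋀P⟧_V ⊆ ⟦Ψ₂⟧_V, then ⟦⋀P⟧_V ∩ ⟦Id⟧_V ⊆ ⟦Ψ₁ ⌢ Ψ₂⟧_V. -/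
/-- `⟦⋀P⟧_V` for a set `P` of state predicates: the traces whose first state
satisfies every predicate in `P`. -/
def semPredSet {State RVar : Type} [DecidableEq RVar]
    (P : Set (State → Prop)) (V : RVar → Set (Trace State)) : Set (Trace State) :=
  {t | ∀ p ∈ P, t ∈ sem (TF.pred p : TF State RVar) V}

/-- Local soundness of rule END-ID: if
`⟦⋀P⟧_V ∩ ⟦Id⟧_V ⊆ ⟦Ψ₁⟧_V` and `⟦⋀P⟧_V ⊆ ⟦Ψ₂⟧_V`, then
`⟦⋀P⟧_V ∩ ⟦Id⟧_V ⊆ ⟦Ψ₁ ⌢ Ψ₂⟧_V`. -/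
theorem end_id_sound {State RVar : Type} [DecidableEq RVar]
    (P : Set (State → Prop)) (Ψ₁ Ψ₂ : TF State RVar)
    (V : RVar → Set (Trace State))
    (h1 : semPredSet P V ∩ sem (TF.rel (fun s s' => s = s') : TF State RVar) V ⊆
      sem Ψ₁ V)
    (h2 : semPredSet P V ⊆ sem Ψ₂ V) :
    semPredSet P V ∩ sem (TF.rel (fun s s' => s = s') : TF State RVar) V ⊆
      sem (TF.chop Ψ₁ Ψ₂) V := by
  rintro ⟨t, ht⟩ ⟨hP, hI⟩
  have hI' := hI
  simp only [sem, Set.mem_setOf_eq] at hI'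
  obtain ⟨s, s', hts, rfl⟩ := hI'
  subst hts
  simp only [sem, chopSet, Set.mem_setOf_eq]
  refine ⟨[s], [], s, rfl, h1 ⟨hP, hI⟩, h2 ?_⟩
  intro p hp
  have h := hP p hp
  simp only [sem, Set.mem_setOf_eq] at h ⊢
  obtain ⟨a, σ, he, ha⟩ := h
  cases he
  exact ⟨s, [], rfl, ha⟩
end
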